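/- (Sarason's theorem on ℝⁿ) For f ∈ BMO(ℝⁿ), lim_{t→0⁺} ω(f,t) = 0 if and only if there exist uniformly continuous functions g_j ∈ BMO(ℝⁿ) with ‖f − g_j‖_{BMO(ℝⁿ)} → 0. -/

import Mathlib

open MeasureTheory Metric Filter Topology

noncomputable section

/-- A closed axis-parallel cube in ℝⁿ: a closed ball in the sup norm with
positive radius (`half` = half the sidelength). -/
structure Cube (n : ℕ) where
  center : Fin n → ℝ
  half : ℝ
  half_pos : 0 < half

namespace Cube

variable {n : ℕ}

/-- The underlying set of a cube. -/
def toSet (Q : Cube n) : Set (Fin n → ℝ) := Metric.closedBall Q.center Q.half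

/-- The sidelength ℓ(Q). -/
def side (Q : Cube n) : ℝ := 2 * Q.half

/-- The mean f_Q of f over Q. -/
def avg (Q : Cube n) (f : (Fin n → ℝ) → ℝ) : ℝ := ⨍ x in Q.toSet, f x

/-- Mean oscillation of f over Q. -/
def osc (Q : Cube n) (f : (Fin n → ℝ) → ℝ) : ℝ := ⨍ x in Q.toSet, |f x - Q.avg f|

/-- The mean |f|_Q of |f| over Q. -/
def avgAbs (Q : Cube n) (f : (Fin n → ℝ) → ℝ) : ℝ := ⨍ x in Q.toSet, |f x|

/-- Distance from the cube to the origin. -/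
def distToOrigin (Q : Cube n) : ℝ := Metric.infDist (0 : Fin n → ℝ) Q.toSet

/-- The cube 2Q, concentric with Q and of twice the sidelength. -/
def double (Q : Cube n) : Cube n := ⟨Q.center, 2 * Q.half, mul_pos two_pos Q.half_pos⟩

end Cube

variable {n : ℕ}

/-- The modulus of mean oscillation ω_U(f,t): the supremum of the mean oscillation
of f over cubes Q ⊆ U of sidelength < t. -/
def omegaOn (U : Set (Fin n → ℝ)) (f : (Fin n → ℝ) → ℝ) (t : ℝ) : ℝ :=
  sSup {r | ∃ Q : Cube n, Q.toSet ⊆ U ∧ Q.side < t ∧ r = Q.osc f}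

/-- sup{ |f|_Q : Q ⊆ U, ℓ(Q) ≥ lam }. -/
def bigAvgSup (U : Set (Fin n → ℝ)) (lam : ℝ) (f : (Fin n → ℝ) → ℝ) : ℝ :=
  sSup {r | ∃ Q : Cube n, Q.toSet ⊆ U ∧ lam ≤ Q.side ∧ r = Q.avgAbs f}

/-- The nonhomogeneous norm ‖f‖_{bmo_lam(U)}. -/
def bmoNorm (U : Set (Fin n → ℝ)) (lam : ℝ) (f : (Fin n → ℝ) → ℝ) : ℝ :=
  omegaOn U f lam + bigAvgSup U lam f

/-- Membership in bmo_lam(U): integrable on every cube in U and finite norm. -/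
def MemBmo (U : Set (Fin n → ℝ)) (lam : ℝ) (f : (Fin n → ℝ) → ℝ) : Prop :=
  (∀ Q : Cube n, Q.toSet ⊆ U → IntegrableOn f Q.toSet) ∧
  BddAbove {r | ∃ Q : Cube n, Q.toSet ⊆ U ∧ Q.side < lam ∧ r = Q.osc f} ∧
  BddAbove {r | ∃ Q : Cube n, Q.toSet ⊆ U ∧ lam ≤ Q.side ∧ r = Q.avgAbs f}

/-- Sarason's vanishing mean oscillation condition: ω_U(f,t) → 0 as t → 0⁺. -/
def VanishSmallOsc (U : Set (Fin n → ℝ)) (f : (Fin n → ℝ) → ℝ) : Prop :=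
  Tendsto (fun t => omegaOn U f t) (nhdsWithin 0 (Set.Ioi 0)) (nhds 0)

/-- f is bounded on U. -/
def BoundedOn (U : Set (Fin n → ℝ)) (f : (Fin n → ℝ) → ℝ) : Prop :=
  ∃ M : ℝ, ∀ x ∈ U, |f x| ≤ M

/-- f is Lipschitz on U. -/
def LipschitzOn (U : Set (Fin n → ℝ)) (f : (Fin n → ℝ) → ℝ) : Prop :=
  ∃ K : NNReal, LipschitzOnWith K f U

/-- dist(supp f, ∂U) > 0. -/
def SuppAway (U : Set (Fin n → ℝ)) (f : (Fin n → ℝ) → ℝ) : Prop :=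
  ∃ d > 0, ∀ x ∈ Function.support f, ∀ y ∈ frontier U, d ≤ dist x y

/-- The nonhomogeneous Lipschitz norm ‖f‖_{Lip_b(U)} = ‖f‖_∞ + Lipschitz seminorm. -/
def lipbNorm (U : Set (Fin n → ℝ)) (f : (Fin n → ℝ) → ℝ) : ℝ :=
  sSup {r | ∃ x ∈ U, r = |f x|} +
  sSup {r | ∃ x ∈ U, ∃ y ∈ U, x ≠ y ∧ r = |f x - f y| / dist x y}

/-- U is a domain: a nonempty open connected subset of ℝⁿ. -/
def IsRealDomain (U : Set (Fin n → ℝ)) : Prop := IsOpen U ∧ IsConnected U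

/-- U is an (ε,δ)-domain. -/
def IsEpsDeltaDomain (U : Set (Fin n → ℝ)) (ε δ : ℝ) : Prop :=
  ∀ x ∈ U, ∀ y ∈ U, dist x y < δ →
    ∃ γ : ℝ → (Fin n → ℝ), ContinuousOn γ (Set.Icc 0 1) ∧ γ 0 = x ∧ γ 1 = y ∧
      (∀ t ∈ Set.Icc (0:ℝ) 1, γ t ∈ U) ∧
      eVariationOn γ (Set.Icc 0 1) ≤ ENNReal.ofReal (ε⁻¹ * dist x y) ∧
      ∀ t ∈ Set.Icc (0:ℝ) 1,
        ε * (dist (γ t) x * dist (γ t) y) / dist x y ≤ Metric.infDist (γ t) (frontier U)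

/-- The natural scale λ_{ε,δ} for an (ε,δ)-domain. -/
def lamED (n : ℕ) (ε δ : ℝ) : ℝ := ε ^ 2 * δ / (320 * n * (1 + Real.sqrt n * ε))

/-- d_Ω(x) = dist(x,∂Ω). -/
def distBd (U : Set (Fin n → ℝ)) (x : Fin n → ℝ) : ℝ := Metric.infDist x (frontier U)

/-- Ω̊_t = {x ∈ Ω : d_Ω(x) ≥ t}. -/
def innerPart (U : Set (Fin n → ℝ)) (t : ℝ) : Set (Fin n → ℝ) :=
  {x ∈ U | t ≤ distBd U x}

/-- f vanishes at infinity in the bmo_lam(U) sense. -/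
def VanishAtInfinity (U : Set (Fin n → ℝ)) (lam : ℝ) (f : (Fin n → ℝ) → ℝ) : Prop :=
  Tendsto (fun R => bmoNorm (U \ Metric.closedBall 0 R) lam f) atTop (nhds 0)

/-- f vanishes at the boundary in the bmo_lam(U) sense. -/
def VanishAtBoundary (U : Set (Fin n → ℝ)) (lam : ℝ) (f : (Fin n → ℝ) → ℝ) : Prop :=
  Tendsto (fun t => bmoNorm (U \ innerPart U t) lam f) (nhdsWithin 0 (Set.Ioi 0)) (nhds 0)

/-- f is in the bmo_lam(U)-closure of the continuous functions with compact support in U. -/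
def InCmoClosure (U : Set (Fin n → ℝ)) (lam : ℝ) (f : (Fin n → ℝ) → ℝ) : Prop :=
  ∃ g : ℕ → (Fin n → ℝ) → ℝ,
    (∀ j, Continuous (g j) ∧ HasCompactSupport (g j) ∧ tsupport (g j) ⊆ U) ∧
    Tendsto (fun j => bmoNorm U lam (f - g j)) atTop (nhds 0)

/-- The homogeneous BMO(ℝⁿ) seminorm: sup of mean oscillation over all cubes. -/
def bmoHNorm (f : (Fin n → ℝ) → ℝ) : ℝ := sSup {r | ∃ Q : Cube n, r = Q.osc f}

namespace Cube

variable (Q : Cube n)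

lemma toSet_eq : Q.toSet = closedBall Q.center Q.half := rfl

/-- The volume of a cube. -/
def vol (Q : Cube n) : ℝ := (2 * Q.half) ^ n

lemma vol_pos : 0 < Q.vol := pow_pos (mul_pos two_pos Q.half_pos) n

lemma measureReal_toSet : volume.real Q.toSet = Q.vol := by
  rw [measureReal_def, toSet, Real.volume_pi_closedBall _ Q.half_pos.le,
    ENNReal.toReal_ofReal (pow_nonneg (mul_nonneg two_pos.le Q.half_pos.le) _), Fintype.card_fin,
    vol]

lemma measurableSet_toSet : MeasurableSet Q.toSet := measurableSet_closedBall

lemma volume_toSet_ne_top : volume Q.toSet ≠ ⊤ := (isCompact_closedBall _ _).measure_ne_top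

lemma integrableOn_const (c : ℝ) : IntegrableOn (fun _ => c) Q.toSet volume :=
  MeasureTheory.integrableOn_const Q.volume_toSet_ne_top

lemma setIntegral_const (c : ℝ) : ∫ _ in Q.toSet, c = Q.vol * c := by
  rw [MeasureTheory.setIntegral_const, measureReal_toSet, smul_eq_mul]

lemma vol_mul_avg (h : (Fin n → ℝ) → ℝ) : Q.vol * Q.avg h = ∫ x in Q.toSet, h x := by
  rw [avg, setAverage_eq, measureReal_toSet, smul_eq_mul, mul_inv_cancel_left₀ Q.vol_pos.ne']

lemma vol_mul_osc (h : (Fin n → ℝ) → ℝ) :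
    Q.vol * Q.osc h = ∫ x in Q.toSet, |h x - Q.avg h| := by
  rw [osc, setAverage_eq, measureReal_toSet, smul_eq_mul, mul_inv_cancel_left₀ Q.vol_pos.ne']

lemma osc_nonneg (h : (Fin n → ℝ) → ℝ) : 0 ≤ Q.osc h := by
  refine le_of_mul_le_mul_left ?_ Q.vol_pos
  rw [mul_zero, vol_mul_osc]
  exact integral_nonneg fun _ => abs_nonneg _

variable {Q}

lemma integrableOn_abs_sub {h : (Fin n → ℝ) → ℝ} (hh : IntegrableOn h Q.toSet) (c : ℝ) :
    IntegrableOn (fun x => |h x - c|) Q.toSet :=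
  (hh.sub (Q.integrableOn_const c)).abs

/-- The mean oscillation is at most twice the mean deviation from any constant. -/
lemma osc_le_two_mul {h : (Fin n → ℝ) → ℝ} (hh : IntegrableOn h Q.toSet) {c M : ℝ}
    (hM : ∫ x in Q.toSet, |h x - c| ≤ Q.vol * M) : Q.osc h ≤ 2 * M := by
  have hV := Q.vol_pos
  have h1 : |Q.avg h - c| ≤ M := by
    refine le_of_mul_le_mul_left ?_ hV
    calc Q.vol * |Q.avg h - c| = |Q.vol * Q.avg h - Q.vol * c| := by
          rw [← mul_sub, abs_mul, abs_of_pos hV]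
      _ = |∫ x in Q.toSet, (h x - c)| := by
          rw [vol_mul_avg, ← setIntegral_const, integral_sub hh (Q.integrableOn_const c)]
      _ ≤ ∫ x in Q.toSet, |h x - c| := abs_integral_le_integral_abs
      _ ≤ _ := hM
  refine le_of_mul_le_mul_left ?_ hV
  calc Q.vol * Q.osc h = ∫ x in Q.toSet, |h x - Q.avg h| := Q.vol_mul_osc h
    _ ≤ ∫ x in Q.toSet, (|h x - c| + M) := by
        refine integral_mono (integrableOn_abs_sub hh _)
          ((integrableOn_abs_sub hh c).add (Q.integrableOn_const M)) fun x => ?_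
        have := abs_sub_le (h x) c (Q.avg h)
        rw [abs_sub_comm c] at this
        dsimp only
        linarith
    _ = (∫ x in Q.toSet, |h x - c|) + Q.vol * M := by
        rw [integral_add (integrableOn_abs_sub hh c) (Q.integrableOn_const M), setIntegral_const]
    _ ≤ Q.vol * (2 * M) := by linarith

lemma osc_le_two_mul_of_forall {h : (Fin n → ℝ) → ℝ} (hh : IntegrableOn h Q.toSet) {c M : ℝ}
    (hM : ∀ x ∈ Q.toSet, |h x - c| ≤ M) : Q.osc h ≤ 2 * M := by
  refine osc_le_two_mul hh (c := c) ?_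
  rw [← setIntegral_const]
  exact setIntegral_mono_on (integrableOn_abs_sub hh c) (Q.integrableOn_const M)
    Q.measurableSet_toSet hM

lemma osc_add_le {a b : (Fin n → ℝ) → ℝ} (ha : IntegrableOn a Q.toSet)
    (hb : IntegrableOn b Q.toSet) : Q.osc (a + b) ≤ Q.osc a + Q.osc b := by
  have hV := Q.vol_pos
  have havg : Q.avg (a + b) = Q.avg a + Q.avg b := by
    refine mul_left_cancel₀ hV.ne' ?_
    rw [mul_add]
    simp only [vol_mul_avg]
    exact integral_add ha hb
  refine le_of_mul_le_mul_left ?_ hV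
  rw [mul_add, vol_mul_osc, vol_mul_osc, vol_mul_osc,
    ← integral_add (integrableOn_abs_sub ha _) (integrableOn_abs_sub hb _)]
  refine integral_mono (integrableOn_abs_sub (ha.add hb) _)
    ((integrableOn_abs_sub ha _).add (integrableOn_abs_sub hb _)) fun x => ?_
  rw [havg]
  dsimp only
  rw [Pi.add_apply, add_sub_add_comm]
  exact abs_add_le _ _

lemma osc_neg (a : (Fin n → ℝ) → ℝ) : Q.osc (-a) = Q.osc a := by
  have hV := Q.vol_pos
  have havg : Q.avg (-a) = -Q.avg a := by
    refine mul_left_cancel₀ hV.ne' ?_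
    rw [mul_neg]
    simp only [vol_mul_avg]
    exact integral_neg _
  refine mul_left_cancel₀ hV.ne' ?_
  rw [vol_mul_osc, vol_mul_osc, havg]
  refine integral_congr_ae (ae_of_all _ fun x => ?_)
  dsimp only
  rw [Pi.neg_apply, ← neg_sub', abs_neg]

lemma integrableOn_toSet {h : (Fin n → ℝ) → ℝ} (hh : LocallyIntegrable h volume) (Q : Cube n) :
    IntegrableOn h Q.toSet :=
  hh.integrableOn_isCompact (isCompact_closedBall _ _)

end Cube

/-- A closed ball of radius `2 * r` in the sup norm is covered by `2 ^ n` balls of radius `r`. -/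
lemma closedBall_two_mul_subset (c : Fin n → ℝ) {r : ℝ} (hr : 0 ≤ r) :
    closedBall c (2 * r) ⊆
      ⋃ s : Fin n → Bool, closedBall (fun i => c i + if s i then r else -r) r := by
  intro x hx
  rw [mem_closedBall, dist_pi_le_iff (by linarith)] at hx
  refine Set.mem_iUnion.2 ⟨fun i => decide (c i ≤ x i), ?_⟩
  rw [mem_closedBall, dist_pi_le_iff hr]
  intro i
  have := abs_le.1 (Real.dist_eq (x i) (c i) ▸ hx i)
  rw [Real.dist_eq, abs_le]
  by_cases h : c i ≤ x i
  · simp only [h, decide_true, if_true]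
    constructor <;> linarith
  · simp only [h, decide_false]
    rw [if_neg (by simp)]
    constructor <;> linarith [not_le.1 h]

/-- If the integral of `h` over cubes with half-side in `[t, 2t]` is controlled by the volume, then
so is the integral over every larger cube. -/
lemma setLIntegral_closedBall_le {h : (Fin n → ℝ) → ENNReal} {t : ℝ} (ht : 0 < t) {M : ENNReal}
    (hM : ∀ (c : Fin n → ℝ) (r : ℝ), t ≤ r → r ≤ 2 * t →
      ∫⁻ x in closedBall c r, h x ≤ M * ENNReal.ofReal ((2 * r) ^ n))
    (c : Fin n → ℝ) (r : ℝ) (hr : t ≤ r) :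
    ∫⁻ x in closedBall c r, h x ≤ M * ENNReal.ofReal ((2 * r) ^ n) := by
  have key : ∀ (k : ℕ) (c : Fin n → ℝ) (r : ℝ), t ≤ r → r ≤ 2 ^ (k + 1) * t →
      ∫⁻ x in closedBall c r, h x ≤ M * ENNReal.ofReal ((2 * r) ^ n) := by
    intro k
    induction k with
    | zero => intro c r h1 h2; exact hM c r h1 (by simpa using h2)
    | succ k ih =>
      intro c r h1 h2
      by_cases h3 : r ≤ 2 * t
      · exact hM c r h1 h3
      have h4 : t ≤ r / 2 := by linarith
      have h5 : r / 2 ≤ 2 ^ (k + 1) * t := by rw [pow_succ] at h2; linarith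
      calc ∫⁻ x in closedBall c r, h x
          ≤ ∫⁻ x in ⋃ s : Fin n → Bool,
              closedBall (fun i => c i + if s i then r / 2 else -(r / 2)) (r / 2), h x := by
            refine lintegral_mono_set ?_
            have := closedBall_two_mul_subset c (r := r / 2) (by linarith)
            rwa [mul_div_cancel₀ r two_ne_zero] at this
        _ ≤ ∑ s : Fin n → Bool, ∫⁻ x in
              closedBall (fun i => c i + if s i then r / 2 else -(r / 2)) (r / 2), h x := by
            rw [← tsum_fintype (L := .unconditional _)]
            exact lintegral_iUnion_le _ _
        _ ≤ ∑ _s : Fin n → Bool, M * ENNReal.ofReal ((2 * (r / 2)) ^ n) :=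
            Finset.sum_le_sum fun s _ => ih _ _ h4 h5
        _ = M * ENNReal.ofReal ((2 * r) ^ n) := by
            rw [Finset.sum_const, Finset.card_univ, Fintype.card_fun, Fintype.card_bool,
              Fintype.card_fin, nsmul_eq_mul, mul_pow 2 r, mul_div_cancel₀ r two_ne_zero,
              ENNReal.ofReal_mul (by positivity), ENNReal.ofReal_pow zero_le_two,
              ENNReal.ofReal_ofNat]
            push_cast
            ring
  obtain ⟨k, hk⟩ := pow_unbounded_of_one_lt (r / t) (one_lt_two (α := ℝ))
  refine key k c r hr ?_
  rw [div_lt_iff₀ ht] at hk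
  rw [pow_succ]
  nlinarith [pow_pos (two_pos (α := ℝ)) k]

lemma setIntegral_abs_le_of_forall_cube {h : (Fin n → ℝ) → ℝ} (hh : LocallyIntegrable h volume)
    {t M : ℝ} (ht : 0 < t)
    (hM : ∀ Q : Cube n, t ≤ Q.half → Q.half ≤ 2 * t → ∫ x in Q.toSet, |h x| ≤ Q.vol * M)
    (Q : Cube n) (hQ : t ≤ Q.half) : ∫ x in Q.toSet, |h x| ≤ Q.vol * M := by
  have conv : ∀ P : Cube n, ∫⁻ x in closedBall P.center P.half, ENNReal.ofReal |h x| =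
      ENNReal.ofReal (∫ x in P.toSet, |h x|) := fun P =>
    (ofReal_integral_eq_lintegral_ofReal (Cube.integrableOn_toSet hh P).abs
      (ae_of_all _ fun _ => abs_nonneg _)).symm
  have hM0 : 0 ≤ M := by
    let P : Cube n := ⟨0, t, ht⟩
    exact nonneg_of_mul_nonneg_right
      ((integral_nonneg fun _ => abs_nonneg _).trans (hM P le_rfl (by dsimp [P]; linarith)))
      P.vol_pos
  have := setLIntegral_closedBall_le (h := fun x => ENNReal.ofReal |h x|) (n := n) ht
    (M := ENNReal.ofReal M) (fun c r h1 h2 => by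
      let P : Cube n := ⟨c, r, ht.trans_le h1⟩
      rw [conv P, ← ENNReal.ofReal_mul hM0, mul_comm]
      exact ENNReal.ofReal_le_ofReal (hM P h1 h2)) Q.center Q.half hQ
  rw [conv Q, ← ENNReal.ofReal_mul hM0, mul_comm] at this
  exact (ENNReal.ofReal_le_ofReal_iff (mul_nonneg Q.vol_pos.le hM0)).1 this

/-- The tent function of height and radius `t` centred at `x`. -/
def tent (t : ℝ) (x z : Fin n → ℝ) : ℝ := max 0 (t - dist z x)

lemma tent_nonneg (t : ℝ) (x z : Fin n → ℝ) : 0 ≤ tent t x z := le_max_left _ _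

lemma tent_le {t : ℝ} (ht : 0 ≤ t) (x z : Fin n → ℝ) : tent t x z ≤ t :=
  max_le ht (sub_le_self _ dist_nonneg)

lemma tent_eq_zero {t : ℝ} {x z : Fin n → ℝ} (h : z ∉ closedBall x t) : tent t x z = 0 :=
  max_eq_left (by rw [mem_closedBall, not_le] at h; linarith)

lemma continuous_tent (t : ℝ) (x : Fin n → ℝ) : Continuous (tent t x) := by
  unfold tent; fun_prop

lemma hasCompactSupport_tent (t : ℝ) (x : Fin n → ℝ) : HasCompactSupport (tent t x) :=
  HasCompactSupport.intro (isCompact_closedBall x t) fun _ => tent_eq_zero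

lemma abs_tent_sub_tent_le (t : ℝ) (x y z : Fin n → ℝ) :
    |tent t x z - tent t y z| ≤ dist x y := by
  refine (abs_max_sub_max_le_max _ _ _ _).trans (max_le (by simp) ?_)
  rw [sub_sub_sub_cancel_left, dist_comm z y, dist_comm z x, dist_comm x y]
  exact abs_dist_sub_le y x z

lemma integrable_tent_mul (t : ℝ) (x : Fin n → ℝ) {h : (Fin n → ℝ) → ℝ}
    (hh : LocallyIntegrable h volume) : Integrable (fun z => tent t x z * h z) volume :=
  hh.integrable_smul_left_of_hasCompactSupport (continuous_tent t x) (hasCompactSupport_tent t x)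

lemma integral_tent (t : ℝ) (x : Fin n → ℝ) : ∫ z, tent t x z = ∫ z, tent t (0 : Fin n → ℝ) z := by
  rw [← integral_sub_right_eq_self (tent t 0) x]
  simp only [tent, dist_eq_norm, sub_zero]

lemma le_integral_tent {t : ℝ} (ht : 0 < t) : t ^ n * (t / 2) ≤ ∫ z, tent t (0 : Fin n → ℝ) z := by
  let P : Cube n := ⟨0, t / 2, half_pos ht⟩
  have hi : Integrable (tent t (0 : Fin n → ℝ)) volume :=
    (continuous_tent t 0).integrable_of_hasCompactSupport (hasCompactSupport_tent t 0)
  have hv : P.vol = t ^ n := by simp only [P, Cube.vol]; congr 1; ring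
  calc t ^ n * (t / 2) = ∫ _ in P.toSet, t / 2 := by rw [Cube.setIntegral_const, hv]
    _ ≤ ∫ z in P.toSet, tent t 0 z := by
        refine setIntegral_mono_on (P.integrableOn_const _) hi.integrableOn
          P.measurableSet_toSet fun z hz => le_max_of_le_right ?_
        have : dist z 0 ≤ t / 2 := hz
        linarith
    _ ≤ ∫ z, tent t 0 z :=
        setIntegral_le_integral hi (ae_of_all _ fun z => tent_nonneg _ _ _)

lemma integral_tent_pos {t : ℝ} (ht : 0 < t) : 0 < ∫ z, tent t (0 : Fin n → ℝ) z :=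
  lt_of_lt_of_le (by positivity) (le_integral_tent ht)

/-- The mean of `f` weighted by the tent function of radius `t` centred at `x`. -/
def tentAvg (t : ℝ) (f : (Fin n → ℝ) → ℝ) (x : Fin n → ℝ) : ℝ :=
  (∫ z, tent t (0 : Fin n → ℝ) z)⁻¹ * ∫ z, tent t x z * f z

lemma tentAvg_sub_const {t : ℝ} (ht : 0 < t) {f : (Fin n → ℝ) → ℝ}
    (hf : LocallyIntegrable f volume) (x : Fin n → ℝ) (c : ℝ) :
    tentAvg t f x - c =
      (∫ z, tent t (0 : Fin n → ℝ) z)⁻¹ * ∫ z, tent t x z * (f z - c) := by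
  have h : ∫ z, tent t x z * (f z - c) =
      (∫ z, tent t x z * f z) - (∫ z, tent t (0 : Fin n → ℝ) z) * c := by
    simp only [mul_sub]
    rw [integral_sub (integrable_tent_mul t x hf)
      (integrable_tent_mul t x (locallyIntegrable_const c)), integral_mul_const, integral_tent]
  rw [h, mul_sub, inv_mul_cancel_left₀ (integral_tent_pos ht).ne', tentAvg]

lemma abs_integral_mul_le {Q : Cube n} {k h : (Fin n → ℝ) → ℝ} {K : ℝ}
    (hh : IntegrableOn h Q.toSet) (hK : ∀ z, |k z| ≤ K) (hk : ∀ z, z ∉ Q.toSet → k z = 0) :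
    |∫ z, k z * h z| ≤ K * ∫ z in Q.toSet, |h z| := by
  rw [← setIntegral_eq_integral_of_forall_compl_eq_zero (s := Q.toSet)
    fun z hz => by rw [hk z hz, zero_mul], ← integral_const_mul]
  refine abs_integral_le_integral_abs.trans (integral_mono_of_nonneg
    (ae_of_all _ fun _ => abs_nonneg _) (hh.abs.const_mul K) (ae_of_all _ fun z => ?_))
  dsimp only
  rw [abs_mul]
  exact mul_le_mul_of_nonneg_right (hK z) (abs_nonneg _)

/-- Near a cube, the weighted mean of `f` is close to the mean of `f` over an enlarged cube. -/
lemma abs_tentAvg_sub_avg_le {t : ℝ} (ht : 0 < t) {f : (Fin n → ℝ) → ℝ}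
    (hf : LocallyIntegrable f volume) {x p : Fin n → ℝ} {r : ℝ} (hr : r ≤ 2 * t)
    (hx : x ∈ closedBall p r) {P : Cube n} (hc : P.center = p) (hP : P.half = r + t) :
    |tentAvg t f x - P.avg f| ≤ 2 * 6 ^ n * P.osc f := by
  have hsub : closedBall x t ⊆ P.toSet := by
    rw [Cube.toSet_eq, hc, hP]
    exact closedBall_subset_closedBall' (by rw [mem_closedBall] at hx; linarith)
  have hW := integral_tent_pos (n := n) ht
  rw [tentAvg_sub_const ht hf, abs_mul, abs_inv, abs_of_pos hW, inv_mul_le_iff₀ hW]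
  have hfc : IntegrableOn (fun z => f z - P.avg f) P.toSet :=
    (Cube.integrableOn_toSet hf P).sub (P.integrableOn_const (P.avg f))
  have h1 := abs_integral_mul_le (k := tent t x) (K := t) hfc
    (fun z => by rw [abs_of_nonneg (tent_nonneg t x z)]; exact tent_le ht.le x z)
    (fun z hz => tent_eq_zero fun h => hz (hsub h))
  refine h1.trans ?_
  have h3 : P.vol ≤ (6 * t) ^ n :=
    pow_le_pow_left₀ (by linarith [P.half_pos]) (by linarith) n
  have h4 := P.osc_nonneg f
  rw [← P.vol_mul_osc]
  calc t * (P.vol * P.osc f) ≤ t * ((6 * t) ^ n * P.osc f) := by gcongr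
    _ = (t ^ n * (t / 2)) * (2 * 6 ^ n * P.osc f) := by rw [mul_pow]; ring
    _ ≤ _ := by gcongr; exact le_integral_tent ht

lemma abs_tentAvg_sub_tentAvg_le {t : ℝ} (ht : 0 < t) {f : (Fin n → ℝ) → ℝ}
    (hf : LocallyIntegrable f volume) {x y : Fin n → ℝ} (hxy : dist x y ≤ t)
    {P : Cube n} (hc : P.center = x) (hP : P.half = 2 * t) :
    |tentAvg t f x - tentAvg t f y| ≤
      (∫ z, tent t (0 : Fin n → ℝ) z)⁻¹ * (dist x y * (P.vol * P.osc f)) := by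
  have hW := integral_tent_pos (n := n) ht
  have hfc : IntegrableOn (fun z => f z - P.avg f) P.toSet :=
    (Cube.integrableOn_toSet hf P).sub (P.integrableOn_const (P.avg f))
  have hfl : LocallyIntegrable (fun z => f z - P.avg f) volume :=
    hf.sub (locallyIntegrable_const _)
  have hx : closedBall x t ⊆ P.toSet := by
    rw [Cube.toSet_eq, hc, hP]
    exact closedBall_subset_closedBall (by linarith)
  have hy : closedBall y t ⊆ P.toSet := by
    rw [Cube.toSet_eq, hc, hP]
    exact closedBall_subset_closedBall' (by rw [dist_comm]; linarith)
  have h1 := abs_integral_mul_le (k := fun z => tent t x z - tent t y z) (K := dist x y) hfc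
    (fun z => abs_tent_sub_tent_le t x y z)
    (fun z hz => by
      rw [tent_eq_zero fun h => hz (hx h), tent_eq_zero fun h => hz (hy h), sub_zero])
  rw [← sub_sub_sub_cancel_right _ _ (P.avg f), tentAvg_sub_const ht hf, tentAvg_sub_const ht hf,
    ← mul_sub, ← integral_sub (integrable_tent_mul t x hfl) (integrable_tent_mul t y hfl), abs_mul,
    abs_inv, abs_of_pos hW, Cube.vol_mul_osc]
  simp only [← sub_mul]
  exact mul_le_mul_of_nonneg_left h1 (inv_nonneg.2 hW.le)

section Approximation

variable {t ε : ℝ} {f : (Fin n → ℝ) → ℝ}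

lemma uniformContinuous_tentAvg (ht : 0 < t) (hf : LocallyIntegrable f volume)
    (hε : ∀ Q : Cube n, Q.half ≤ 2 * t → Q.osc f ≤ ε) : UniformContinuous (tentAvg t f) := by
  have hW := integral_tent_pos (n := n) ht
  have hε0 : 0 ≤ ε := (Cube.osc_nonneg ⟨0, t, ht⟩ f).trans (hε _ (by dsimp only; linarith))
  set L : ℝ := (∫ z, tent t (0 : Fin n → ℝ) z)⁻¹ * ((2 * (2 * t)) ^ n * ε)
  have hL : 0 ≤ L := by positivity
  rw [Metric.uniformContinuous_iff]
  intro η hη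
  refine ⟨min t (η / (L + 1)), lt_min ht (by positivity), fun {x y} hxy => ?_⟩
  let P : Cube n := ⟨x, 2 * t, by positivity⟩
  have h1 := abs_tentAvg_sub_tentAvg_le ht hf (hxy.le.trans (min_le_left _ _)) (P := P) rfl rfl
  have h2 : dist x y < η / (L + 1) := hxy.trans_le (min_le_right _ _)
  rw [lt_div_iff₀ (by positivity)] at h2
  rw [Real.dist_eq]
  calc |tentAvg t f x - tentAvg t f y| ≤ _ := h1
    _ ≤ (∫ z, tent t (0 : Fin n → ℝ) z)⁻¹ * (dist x y * ((2 * (2 * t)) ^ n * ε)) := by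
        gcongr
        · exact P.osc_nonneg f
        · exact le_rfl
        · exact hε P le_rfl
    _ = dist x y * L := by simp only [L]; ring
    _ ≤ dist x y * (L + 1) := by gcongr; linarith
    _ < η := h2

lemma Cube.osc_sub_tentAvg_le (ht : 0 < t) (hf : LocallyIntegrable f volume)
    (hε : ∀ Q : Cube n, Q.half ≤ 3 * t → Q.osc f ≤ ε) (Q : Cube n) :
    Q.osc (f - tentAvg t f) ≤ 6 * 6 ^ n * ε := by
  have hε0 : 0 ≤ ε := (Cube.osc_nonneg ⟨0, t, ht⟩ f).trans (hε _ (by dsimp only; linarith))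
  have h6 : (1 : ℝ) ≤ 6 ^ n := one_le_pow₀ (by norm_num)
  have hg : LocallyIntegrable (tentAvg t f) volume :=
    (uniformContinuous_tentAvg ht hf fun Q hQ =>
      hε Q (hQ.trans (by linarith))).continuous.locallyIntegrable
  have near : ∀ Q : Cube n, Q.half ≤ 2 * t → ∃ P : Cube n, P.center = Q.center ∧
      P.half = Q.half + t ∧ P.osc f ≤ ε ∧
      ∀ x ∈ Q.toSet, |tentAvg t f x - P.avg f| ≤ 2 * 6 ^ n * ε := by
    intro Q hQ
    let P : Cube n := ⟨Q.center, Q.half + t, add_pos Q.half_pos ht⟩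
    have hP : P.osc f ≤ ε := hε P (by dsimp only [P]; linarith)
    exact ⟨P, rfl, rfl, hP, fun x hx =>
      (abs_tentAvg_sub_avg_le ht hf hQ hx (P := P) rfl rfl).trans (by gcongr)⟩
  rcases le_total Q.half t with hQ | hQ
  · obtain ⟨P, -, -, -, hP⟩ := near Q (by linarith)
    have h1 := Cube.osc_le_two_mul_of_forall (integrableOn_toSet hg Q) hP
    have h2 := Cube.osc_add_le (integrableOn_toSet hf Q) (integrableOn_toSet hg Q).neg
    rw [osc_neg, ← sub_eq_add_neg] at h2
    have h3 := hε Q (by linarith)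
    nlinarith
  · have hfg : LocallyIntegrable (f - tentAvg t f) volume := hf.sub hg
    have key := setIntegral_abs_le_of_forall_cube hfg ht (M := 3 * 6 ^ n * ε) (fun Q h1 h2 => by
      obtain ⟨P, hPc, hPh, hPε, hP⟩ := near Q h2
      have hQP : Q.toSet ⊆ P.toSet := by
        rw [toSet_eq, toSet_eq, hPc, hPh]
        exact closedBall_subset_closedBall (by linarith)
      have hvol : P.vol ≤ 6 ^ n * Q.vol := by
        rw [vol, vol, ← mul_pow, hPh]
        exact pow_le_pow_left₀ (by linarith) (by linarith) n
      have hfP := integrableOn_abs_sub (integrableOn_toSet hf P) (P.avg f)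
      calc ∫ x in Q.toSet, |(f - tentAvg t f) x|
          ≤ ∫ x in Q.toSet, (|f x - P.avg f| + 2 * 6 ^ n * ε) := by
            refine setIntegral_mono_on (integrableOn_toSet hfg Q).abs
              ((hfP.mono_set hQP).add (Q.integrableOn_const _)) Q.measurableSet_toSet fun x hx => ?_
            have h3 := abs_sub_le (f x) (P.avg f) (tentAvg t f x)
            rw [abs_sub_comm (P.avg f)] at h3
            exact h3.trans (by gcongr; exact hP x hx)
        _ = (∫ x in Q.toSet, |f x - P.avg f|) + Q.vol * (2 * 6 ^ n * ε) := by
            rw [integral_add (hfP.mono_set hQP) (Q.integrableOn_const _), setIntegral_const]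
        _ ≤ (∫ x in P.toSet, |f x - P.avg f|) + Q.vol * (2 * 6 ^ n * ε) := by
            exact add_le_add_left (setIntegral_mono_set hfP (ae_of_all _ fun _ => abs_nonneg _)
              hQP.eventuallyLE) _
        _ ≤ 6 ^ n * Q.vol * ε + Q.vol * (2 * 6 ^ n * ε) := by
            rw [← vol_mul_osc]
            have := P.osc_nonneg f
            have := Q.vol_pos
            gcongr
        _ = Q.vol * (3 * 6 ^ n * ε) := by ring) Q hQ
    have := osc_le_two_mul (c := 0) (integrableOn_toSet hfg Q) (by simpa using key)
    linarith

end Approximation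

lemma vanishSmallOsc_univ_iff {f : (Fin n → ℝ) → ℝ}
    (hf : BddAbove {r | ∃ Q : Cube n, r = Q.osc f}) :
    VanishSmallOsc Set.univ f ↔
      ∀ ε > 0, ∃ t > 0, ∀ Q : Cube n, Q.half ≤ t → Q.osc f ≤ ε := by
  have h0 : ∀ t, 0 ≤ omegaOn Set.univ f t := fun t =>
    Real.sSup_nonneg (by rintro r ⟨Q, -, -, rfl⟩; exact Q.osc_nonneg f)
  rw [VanishSmallOsc, Metric.tendsto_nhdsWithin_nhds]
  simp only [Real.dist_0_eq_abs, abs_of_nonneg (h0 _)]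
  constructor
  · intro h ε hε
    obtain ⟨δ, hδ, H⟩ := h ε hε
    refine ⟨δ / 8, by positivity, fun Q hQ => ?_⟩
    have h1 : omegaOn Set.univ f (δ / 2) < ε :=
      H (Set.mem_Ioi.2 (by positivity)) (by rw [abs_of_pos (by positivity)]; linarith)
    have h2 : BddAbove {r | ∃ Q : Cube n, Q.toSet ⊆ Set.univ ∧ Q.side < δ / 2 ∧ r = Q.osc f} :=
      hf.mono (by rintro r ⟨P, -, -, hr⟩; exact ⟨P, hr⟩)
    exact (le_csSup h2 ⟨Q, Set.subset_univ _, by rw [Cube.side]; linarith, rfl⟩).trans h1.le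
  · intro h ε hε
    obtain ⟨t, ht, H⟩ := h (ε / 2) (half_pos hε)
    refine ⟨t, ht, fun {s} hs hst => ?_⟩
    rw [abs_of_pos hs] at hst
    refine lt_of_le_of_lt (Real.sSup_le ?_ (half_pos hε).le) (half_lt_self hε)
    rintro r ⟨Q, -, hQ, rfl⟩
    rw [Cube.side] at hQ
    exact H Q (by linarith [Q.half_pos])

lemma bmoHNorm_nonneg (f : (Fin n → ℝ) → ℝ) : 0 ≤ bmoHNorm f :=
  Real.sSup_nonneg fun _ ⟨Q, hr⟩ => hr ▸ Q.osc_nonneg f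

lemma UniformContinuous.exists_osc_le {g : (Fin n → ℝ) → ℝ} (hg : UniformContinuous g) {ε : ℝ}
    (hε : 0 < ε) : ∃ t > 0, ∀ Q : Cube n, Q.half ≤ t → Q.osc g ≤ ε := by
  obtain ⟨δ, hδ, H⟩ := Metric.uniformContinuous_iff.1 hg (ε / 2) (half_pos hε)
  refine ⟨δ / 2, half_pos hδ, fun Q hQ => ?_⟩
  have := Cube.osc_le_two_mul_of_forall (Q := Q) (h := g) (c := g Q.center) (M := ε / 2)
    (Cube.integrableOn_toSet hg.continuous.locallyIntegrable Q) fun x hx => by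
      have hx' : dist x Q.center ≤ Q.half := hx
      exact (Real.dist_eq _ _ ▸ H (by linarith : dist x Q.center < δ)).le
  linarith

lemma bddAbove_osc_add {a b : (Fin n → ℝ) → ℝ} (ha : LocallyIntegrable a volume)
    (hb : LocallyIntegrable b volume) (ha' : BddAbove {r | ∃ Q : Cube n, r = Q.osc a})
    (hb' : BddAbove {r | ∃ Q : Cube n, r = Q.osc b}) :
    BddAbove {r | ∃ Q : Cube n, r = Q.osc (a + b)} := by
  obtain ⟨A, hA⟩ := ha'
  obtain ⟨B, hB⟩ := hb'
  refine ⟨A + B, ?_⟩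
  rintro r ⟨Q, rfl⟩
  exact (Cube.osc_add_le (Cube.integrableOn_toSet ha Q) (Cube.integrableOn_toSet hb Q)).trans
    (add_le_add (hA ⟨Q, rfl⟩) (hB ⟨Q, rfl⟩))

lemma bddAbove_osc_neg {a : (Fin n → ℝ) → ℝ} (ha : BddAbove {r | ∃ Q : Cube n, r = Q.osc a}) :
    BddAbove {r | ∃ Q : Cube n, r = Q.osc (-a)} := by
  simpa only [Cube.osc_neg] using ha

/-- Sarason's theorem on ℝⁿ: f ∈ BMO(ℝⁿ) has vanishing mean oscillation iff it is a
BMO-limit of uniformly continuous BMO functions. -/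
theorem stmt3 {n : ℕ} (hn : 0 < n) (f : (Fin n → ℝ) → ℝ)
    (hf : LocallyIntegrable f volume)
    (hf' : BddAbove {r | ∃ Q : Cube n, r = Q.osc f}) :
    VanishSmallOsc Set.univ f ↔
      ∃ g : ℕ → (Fin n → ℝ) → ℝ,
        (∀ j, UniformContinuous (g j) ∧ LocallyIntegrable (g j) volume ∧
          BddAbove {r | ∃ Q : Cube n, r = Q.osc (g j)}) ∧
        Tendsto (fun j => bmoHNorm (f - g j)) atTop (nhds 0) := by
  rw [vanishSmallOsc_univ_iff hf']
  constructor
  · intro h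
    have approx : ∀ j : ℕ, ∃ g : (Fin n → ℝ) → ℝ, (UniformContinuous g ∧
        LocallyIntegrable g volume ∧ BddAbove {r | ∃ Q : Cube n, r = Q.osc g}) ∧
        bmoHNorm (f - g) ≤ 1 / ((j : ℝ) + 1) := by
      intro j
      obtain ⟨t, ht, H⟩ := h (1 / ((j : ℝ) + 1) / (6 * 6 ^ n)) (by positivity)
      have ht3 : 0 < t / 3 := by positivity
      have huc : UniformContinuous (tentAvg (t / 3) f) :=
        uniformContinuous_tentAvg ht3 hf fun Q hQ => H Q (by linarith)
      have hg : LocallyIntegrable (tentAvg (t / 3) f) volume := huc.continuous.locallyIntegrable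
      have hosc : ∀ Q : Cube n, Q.osc (f - tentAvg (t / 3) f) ≤ 1 / ((j : ℝ) + 1) := by
        intro Q
        have := Cube.osc_sub_tentAvg_le ht3 hf (fun Q hQ => H Q (by linarith)) Q
        rwa [mul_div_cancel₀ _ (by positivity)] at this
      refine ⟨tentAvg (t / 3) f, ⟨huc, hg, ?_⟩, Real.sSup_le ?_ (by positivity)⟩
      · have hb : BddAbove {r | ∃ Q : Cube n, r = Q.osc (f - tentAvg (t / 3) f)} :=
          ⟨_, by rintro r ⟨Q, rfl⟩; exact hosc Q⟩
        have := bddAbove_osc_add hf (hf.sub hg).neg hf' (bddAbove_osc_neg hb)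
        rwa [neg_sub, add_sub_cancel] at this
      · rintro r ⟨Q, rfl⟩
        exact hosc Q
    choose g hg hfg using approx
    exact ⟨g, hg, squeeze_zero (fun j => bmoHNorm_nonneg _) hfg
      tendsto_one_div_add_atTop_nhds_zero_nat⟩
  · rintro ⟨g, hg, hlim⟩ ε hε
    obtain ⟨j, hj⟩ := (hlim.eventually_lt_const (half_pos hε)).exists
    obtain ⟨huc, hgi, hgb⟩ := hg j
    obtain ⟨t, ht, H⟩ := huc.exists_osc_le (half_pos hε)
    refine ⟨t, ht, fun Q hQ => ?_⟩
    have hb : BddAbove {r | ∃ Q : Cube n, r = Q.osc (f - g j)} :=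
      sub_eq_add_neg f (g j) ▸ bddAbove_osc_add hf hgi.neg hf' (bddAbove_osc_neg hgb)
    have h1 : Q.osc (f - g j) ≤ bmoHNorm (f - g j) := le_csSup hb ⟨Q, rfl⟩
    have h2 := Cube.osc_add_le (Cube.integrableOn_toSet (hf.sub hgi) Q)
      (Cube.integrableOn_toSet hgi Q)
    rw [sub_add_cancel] at h2
    linarith [H Q hQ]
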